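/- (Equivariant Patching Lemma) Let R be a commutative noetherian ring, P a finitely generated abelian group, and A an associative (not necessarily commutative) R-algebra with R mapping into its center, equipped with a P-grading A = ⊕_{a∈P} A_a. Let A[t] be a polynomial ring over A in a central variable t which is homogeneous of some degree d ∈ P, with the grading extending that of A. Let 0 ≠ f ∈ R and let θ(t) be a unit of A_f[t] with θ(0) = 1 that is homogeneous of degree 0 (G-invariant). Then there exists an integer k ≥ 0 such that for any a, b ∈ R with a − b ∈ f^k R, there is a degree-zero unit ψ(t) of A[t] with ψ(0) = 1 whose image in A_f[t] equals θ(at)·θ(bt)^{-1}. -/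

import Mathlib

open scoped TensorProduct

universe u

/-! ### Properties of commutative (additive) monoids -/

/-- `Q` is cancellative: `a + x = a + y → x = y`. -/
def IsCancellativeAddMonoid (Q : Type*) [AddCommMonoid Q] : Prop :=
  ∀ a x y : Q, a + x = a + y → x = y

/-- `Q` is torsion-free: `n • x = n • y` for some `n > 0` implies `x = y`. -/
def IsTorsionFreeAddMonoid (Q : Type*) [AddCommMonoid Q] : Prop :=
  ∀ n : ℕ, 0 < n → ∀ x y : Q, n • x = n • y → x = y

/-- `Q` is seminormal: an element `x = a - b` of the Grothendieck group with
`2x, 3x ∈ Q` lies in `Q` (stated elementwise via representatives). -/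
def IsSeminormalAddMonoid (Q : Type*) [AddCommMonoid Q] : Prop :=
  ∀ a b : Q, (∃ y : Q, a + a = b + b + y) → (∃ z : Q, a + a + a = b + b + b + z) →
    ∃ w : Q, a = b + w

/-- `Q` is normal: an element `x = a - b` of the Grothendieck group with
`n • x ∈ Q` for some `n > 0` lies in `Q` (stated elementwise via representatives). -/
def IsNormalAddMonoid (Q : Type*) [AddCommMonoid Q] : Prop :=
  ∀ a b : Q, (∃ n : ℕ, 0 < n ∧ ∃ y : Q, n • a = n • b + y) → ∃ w : Q, a = b + w

/-- `Q` has no nontrivial unit: `x + y = 0 → x = 0`. -/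
def HasNoNontrivialAddUnits (Q : Type*) [AddCommMonoid Q] : Prop :=
  ∀ x y : Q, x + y = 0 → x = 0

/-! ### Freeness/extension conditions on rings -/

/-- Every (not necessarily finitely generated) projective `R`-module is free. -/
def AllProjectiveFree (R : Type u) [CommRing R] : Prop :=
  ∀ (M : Type u) [AddCommGroup M] [Module R M], Module.Projective R M → Module.Free R M

/-- Every finitely generated projective `B`-module is free. -/
def AllFGProjectiveFree (B : Type u) [CommRing B] : Prop :=
  ∀ (M : Type u) [AddCommGroup M] [Module B M],
    Module.Finite B M → Module.Projective B M → Module.Free B M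

/-- Every finitely generated projective `B`-module is extended from `R`, i.e. of the form
`B ⊗_R F` for a finitely generated projective `R`-module `F`. -/
def AllFGProjectiveExtended (R B : Type u) [CommRing R] [CommRing B] [Algebra R B] : Prop :=
  ∀ (M : Type u) [AddCommGroup M] [Module B M],
    Module.Finite B M → Module.Projective B M →
    ∃ (F : Type u) (_ : AddCommGroup F) (_ : Module R F),
      Module.Finite R F ∧ Module.Projective R F ∧ Nonempty (M ≃ₗ[B] B ⊗[R] F)

/-- Condition (†): every projective `R`-module is free and every finitely generated
projective module over the group algebra `R[Q]` of a torsion-free abelian group `Q`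
is extended from `R`. -/
def CondDagger (R : Type u) [CommRing R] : Prop :=
  AllProjectiveFree R ∧
  ∀ (Q : Type u) [AddCommGroup Q], IsTorsionFreeAddMonoid Q →
    AllFGProjectiveExtended R (AddMonoidAlgebra R Q)

/-- Condition (††): every projective `R`-module is free and every finitely generated
projective module over `R[Q × ℤ^n]` is extended from `R`, whenever `Q` is torsion-free,
seminormal, cancellative and has no nontrivial unit. -/
def CondDaggerDagger (R : Type u) [CommRing R] : Prop :=
  AllProjectiveFree R ∧
  ∀ (n : ℕ) (Q : Type u) [AddCommMonoid Q],
    IsCancellativeAddMonoid Q → IsTorsionFreeAddMonoid Q → IsSeminormalAddMonoid Q →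
    HasNoNontrivialAddUnits Q →
    AllFGProjectiveExtended R (AddMonoidAlgebra R (Q × (Fin n → ℤ)))

/-! ### Gradings -/

/-- A map `f` is degree-preserving for the gradings `ℳ`, `𝒩`. -/
def MapsGraded {P M N : Type*} {R : Type*} [Semiring R] [AddCommMonoid M] [AddCommMonoid N]
    [Module R M] [Module R N] (f : M → N)
    (ℳ : P → Submodule R M) (𝒩 : P → Submodule R N) : Prop :=
  ∀ c : P, ∀ m ∈ ℳ c, f m ∈ 𝒩 c

/-- `𝒜` is a `P`-grading of the `R`-algebra `A`:
`A = ⊕_{a ∈ P} A_a`, `A_a · A_b ⊆ A_{a+b}`, `1 ∈ A_0`. -/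
structure IsGradedRing {R A P : Type*} [CommRing R] [Ring A] [Algebra R A]
    [AddCommGroup P] [DecidableEq P] (𝒜 : P → Submodule R A) : Prop where
  is_internal : DirectSum.IsInternal 𝒜
  one_mem : (1 : A) ∈ 𝒜 0
  mul_mem : ∀ {a b : P} {x y : A}, x ∈ 𝒜 a → y ∈ 𝒜 b → x * y ∈ 𝒜 (a + b)

/-- `ℳ` is a `P`-grading of the `A`-module `M`, compatible with the grading `𝒜` of `A`:
`M = ⊕_{a ∈ P} M_a` and `A_a • M_b ⊆ M_{a+b}`. -/
structure IsGradedModule {R A P M : Type*} [CommRing R] [Ring A] [Algebra R A]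
    [AddCommGroup P] [DecidableEq P] [AddCommGroup M] [Module R M] [Module A M]
    [IsScalarTower R A M] (𝒜 : P → Submodule R A) (ℳ : P → Submodule R M) : Prop where
  is_internal : DirectSum.IsInternal ℳ
  smul_mem : ∀ {a b : P} {x : A} {m : M}, x ∈ 𝒜 a → m ∈ ℳ b → x • m ∈ ℳ (a + b)

/-- The natural `P`-grading on `B ⊗[R] F`: `(B ⊗ F)_c = ⊕_{a+b=c} B_a ⊗ F_b`. -/
noncomputable def tensorGrading {R B F P : Type*} [CommRing R] [CommRing B] [Algebra R B]
    [AddCommGroup P] [AddCommGroup F] [Module R F]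
    (ℬ : P → Submodule R B) (ℱ : P → Submodule R F) : P → Submodule R (B ⊗[R] F) :=
  fun c => Submodule.span R
    {z | ∃ a b : P, a + b = c ∧ ∃ x ∈ ℬ a, ∃ f ∈ ℱ b, z = x ⊗ₜ[R] f}

/-- A `P`-graded `A`-module `(M, ℳ)` is (equivariantly) extended from `R`, i.e. trivial:
it is isomorphic, as a `P`-graded `A`-module, to `A ⊗_R F` for some `P`-graded `R`-module
`F` which is finitely generated and projective over `R`. -/
def IsGradedExtendedFrom (R : Type u) {A P : Type u} [CommRing R] [CommRing A]
    [Algebra R A] [AddCommGroup P] [DecidableEq P] (𝒜 : P → Submodule R A)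
    (M : Type u) [AddCommGroup M] [Module R M] [Module A M] [IsScalarTower R A M]
    (ℳ : P → Submodule R M) : Prop :=
  ∃ (F : Type u) (_ : AddCommGroup F) (_ : Module R F) (ℱ : P → Submodule R F),
    DirectSum.IsInternal ℱ ∧ Module.Finite R F ∧ Module.Projective R F ∧
    ∃ e : M ≃ₗ[A] A ⊗[R] F,
      MapsGraded (⇑e) ℳ (tensorGrading 𝒜 ℱ) ∧ MapsGraded (⇑e.symm) (tensorGrading 𝒜 ℱ) ℳ

/-! ### Monoid algebras, cones and faces -/

/-- The grading of a monoid algebra `R[Λ]` induced by a degree function `deg : Λ → P`: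
the piece of degree `p` is spanned by the monomials `e_s` with `deg s = p`. -/
noncomputable def monAlgGrading (R : Type*) [CommRing R] {Λ P : Type*} [AddCommMonoid Λ]
    (deg : Λ → P) : P → Submodule R (AddMonoidAlgebra R Λ) :=
  fun p => Submodule.span R {x | ∃ s : Λ, deg s = p ∧ x = AddMonoidAlgebra.single s 1}

/-- The lattice points `σ ∩ L` of the rational polyhedral cone
`σ = ⋂ᵢ (l i)⁻¹(ℚ≥0)` in `L ⊗ ℚ`. -/
def coneLatticePoints {L : Type*} [AddCommGroup L] {q : ℕ} (l : Fin q → L →+ ℚ) :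
    AddSubmonoid L where
  carrier := {m | ∀ i, 0 ≤ l i m}
  zero_mem' := fun i => by simp
  add_mem' := by
    intro a b ha hb i
    rw [map_add]
    exact add_nonneg (ha i) (hb i)

/-- The lattice points `τ ∩ L` of the face `τ = σ ∩ l'⁻¹(0)` of the cone `σ`. -/
def faceLatticePoints {L : Type*} [AddCommGroup L] {q : ℕ} (l : Fin q → L →+ ℚ)
    (l' : L →+ ℚ) : AddSubmonoid L where
  carrier := {m | (∀ i, 0 ≤ l i m) ∧ l' m = 0}
  zero_mem' := ⟨fun i => by simp, by simp⟩
  add_mem' := by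
    intro a b ha hb
    refine ⟨fun i => ?_, ?_⟩
    · rw [map_add]; exact add_nonneg (ha.1 i) (hb.1 i)
    · rw [map_add, ha.2, hb.2, add_zero]

/-- The submonoid of elements of a submonoid `S ⊆ L` killed by `ψ : L →+ P`
(the "invariant" part of `S`). -/
def kerSubmonoidIn {L P : Type*} [AddCommMonoid L] [AddCommMonoid P]
    (S : AddSubmonoid L) (ψ : L →+ P) : AddSubmonoid L where
  carrier := {m | m ∈ S ∧ ψ m = 0}
  zero_mem' := ⟨S.zero_mem, map_zero ψ⟩
  add_mem' := by
    intro a b ha hb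
    exact ⟨S.add_mem ha.1 hb.1, by rw [map_add, ha.2, hb.2, add_zero]⟩

/-- The kernel submonoid `{q ∈ Q | u q = 0}` of a monoid homomorphism `u : Q →+ P`. -/
def kerSubmonoid {Q P : Type*} [AddCommMonoid Q] [AddCommMonoid P] (u : Q →+ P) :
    AddSubmonoid Q where
  carrier := {q | u q = 0}
  zero_mem' := map_zero u
  add_mem' := by
    intro a b ha hb
    simp only [Set.mem_setOf_eq] at *
    rw [map_add, ha, hb, add_zero]

/-- `S` spans `L ⊗ ℚ`: a positive multiple of every lattice element is a difference of
elements of `S` (this expresses that the cone is "strongly convex", i.e. spans `L_ℚ`). -/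
def SpansLattice {L : Type*} [AddCommGroup L] (S : AddSubmonoid L) : Prop :=
  ∀ m : L, ∃ n : ℕ, 0 < n ∧ ∃ x ∈ S, ∃ y ∈ S, (n : ℤ) • m = x - y

/-- The `P`-grading of the polynomial ring `A[t]` over a `P`-graded (possibly
noncommutative) `R`-algebra `A`, where the central variable `t` is homogeneous of
degree `d`: a polynomial is homogeneous of degree `c` iff its `n`-th coefficient lies
in `A_{c - n • d}` for all `n`. -/
def polyGrading {R A P : Type*} [CommRing R] [Ring A] [Algebra R A] [AddCommGroup P]
    (𝒜 : P → Submodule R A) (d : P) : P → Submodule R (Polynomial A) :=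
  fun c =>
  { carrier := {p | ∀ n : ℕ, p.coeff n ∈ 𝒜 (c - n • d)}
    add_mem' := fun {p q} hp hq n => by
      rw [Polynomial.coeff_add]; exact add_mem (hp n) (hq n)
    zero_mem' := fun n => by rw [Polynomial.coeff_zero]; exact zero_mem _
    smul_mem' := fun r p hp n => by
      rw [Polynomial.coeff_smul]; exact Submodule.smul_mem _ r (hp n) }

/-- The `P`-grading of `A_f = A ⊗[R] R_f` (localization at a central `f ∈ R`), induced
from a grading `𝒜` of `A`: the degree-`c` part is spanned by `x ⊗ y` with `x ∈ 𝒜 c`. -/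
noncomputable def tensorLocGrading {R A P : Type*} [CommRing R] [Ring A] [Algebra R A]
    [AddCommGroup P] (𝒜 : P → Submodule R A) (f : R) :
    P → Submodule R (A ⊗[R] Localization.Away f) :=
  fun c => Submodule.span R
    {z | ∃ x ∈ 𝒜 c, ∃ y : Localization.Away f, z = x ⊗ₜ[R] y}

/-! ### Gradings of polynomial rings and of localizations -/

namespace EquivariantPatching

open Polynomial Filter Finset

section Grading

variable {R A P : Type*} [CommRing R] [Ring A] [Algebra R A] [AddCommGroup P]

/-- The inverse of a degree-zero polynomial with constant term `1` has degree zero. -/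
theorem coeff_mem_of_mul_eq_one {𝒜 : P → Submodule R A} (one_mem : (1 : A) ∈ 𝒜 0)
    (mul_mem : ∀ {a b : P} {x y : A}, x ∈ 𝒜 a → y ∈ 𝒜 b → x * y ∈ 𝒜 (a + b)) {d : P}
    {p q : A[X]} (hpq : p * q = 1) (hp0 : p.coeff 0 = 1) (hp : p ∈ polyGrading 𝒜 d 0) :
    q ∈ polyGrading 𝒜 d 0 := by
  intro n
  induction n using Nat.strong_induction_on with
  | _ n ih =>
    have h := congrArg (coeff · n) hpq
    simp only [coeff_mul] at h
    cases n with
    | zero =>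
      have hq : q.coeff 0 = 1 := by simpa [hp0] using h
      simpa [hq] using one_mem
    | succ n =>
      rw [Finset.Nat.sum_antidiagonal_succ, hp0, one_mul, coeff_one,
        if_neg n.succ_ne_zero] at h
      rw [eq_neg_of_add_eq_zero_left h]
      refine neg_mem (sum_mem fun ij hij => ?_)
      have hle : ij.1 + ij.2 = n := mem_antidiagonal.mp hij
      have hmem := mul_mem (hp (ij.1 + 1)) (ih ij.2 (by omega))
      have hdeg : 0 - (ij.1 + 1) • d + (0 - ij.2 • d) = 0 - (n + 1) • d := by
        rw [← hle, add_right_comm, add_smul (ij.1 + 1)]; abel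
      rwa [hdeg] at hmem

variable (𝒜 : P → Submodule R A) (f : R)

theorem one_mem_tensorLocGrading (h : (1 : A) ∈ 𝒜 0) : 1 ∈ tensorLocGrading 𝒜 f 0 :=
  Submodule.subset_span ⟨1, h, 1, rfl⟩

variable {𝒜 f} in
theorem mul_mem_tensorLocGrading
    (mul_mem : ∀ {a b : P} {x y : A}, x ∈ 𝒜 a → y ∈ 𝒜 b → x * y ∈ 𝒜 (a + b))
    {a b : P} {x y : A ⊗[R] Localization.Away f} (hx : x ∈ tensorLocGrading 𝒜 f a)
    (hy : y ∈ tensorLocGrading 𝒜 f b) : x * y ∈ tensorLocGrading 𝒜 f (a + b) := by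
  refine (?_ : tensorLocGrading 𝒜 f a * tensorLocGrading 𝒜 f b ≤ tensorLocGrading 𝒜 f (a + b))
    (Submodule.mul_mem_mul hx hy)
  rw [tensorLocGrading, tensorLocGrading, Submodule.span_mul_span, Submodule.span_le]
  rintro _ ⟨_, ⟨x, hx, u, rfl⟩, _, ⟨y, hy, v, rfl⟩, rfl⟩
  exact Submodule.subset_span ⟨x * y, mul_mem hx hy, u * v, by simp⟩

variable {𝒜} in
/-- A homogeneous element of `A_f` times a large power of `f` lifts to a homogeneous element. -/
theorem eventually_exists_lift {c : P} {x : A ⊗[R] Localization.Away f}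
    (hx : x ∈ tensorLocGrading 𝒜 f c) :
    ∀ᶠ K : ℕ in atTop, ∃ m ∈ 𝒜 c, m ⊗ₜ[R] (1 : Localization.Away f) = f ^ K • x := by
  refine Submodule.span_induction ?_ ?_ ?_ ?_ hx
  · rintro _ ⟨x, hx, y, rfl⟩
    obtain ⟨⟨r, _, n, rfl⟩, hr⟩ := IsLocalization.surj (Submonoid.powers f) y
    filter_upwards [eventually_ge_atTop n] with K hK
    obtain ⟨l, rfl⟩ := Nat.exists_eq_add_of_le hK
    refine ⟨(f ^ l * r) • x, Submodule.smul_mem _ _ hx, ?_⟩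
    have hy : f ^ (n + l) • y = (f ^ l * r) • (1 : Localization.Away f) := by
      simp only [Algebra.smul_def, map_mul, pow_add, mul_one, ← hr]
      ring
    rw [← TensorProduct.tmul_smul, hy, TensorProduct.smul_tmul]
  · exact Eventually.of_forall fun K => ⟨0, zero_mem _, by simp⟩
  · intro x y _ _ hx hy
    filter_upwards [hx, hy] with K ⟨m, hm, hmx⟩ ⟨m', hm', hmy⟩
    exact ⟨m + m', add_mem hm hm', by rw [TensorProduct.add_tmul, hmx, hmy, smul_add]⟩
  · intro r x _ hx
    filter_upwards [hx] with K ⟨m, hm, hmx⟩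
    exact ⟨r • m, Submodule.smul_mem _ _ hm, by
      rw [← TensorProduct.smul_tmul', hmx, smul_comm]⟩

theorem exists_pow_smul_eq_zero_of_tmul_one_eq_zero {m : A}
    (h : m ⊗ₜ[R] (1 : Localization.Away f) = 0) : ∃ n : ℕ, f ^ n • m = 0 := by
  have h' : TensorProduct.mk R (Localization.Away f) A 1 m = 0 := by
    simpa using congrArg (TensorProduct.comm R A (Localization.Away f)) h
  obtain ⟨⟨_, n, rfl⟩, hn⟩ := (IsLocalizedModule.eq_zero_iff (Submonoid.powers f) _).mp h'
  exact ⟨n, hn⟩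

end Grading

/-! ### Uniform annihilation of torsion -/

/-- The `f`-power torsion of a finitely generated submodule is killed by one power of `f`. -/
theorem exists_uniform_pow_smul_eq_zero {R A : Type*} [CommRing R] [IsNoetherianRing R]
    [AddCommGroup A] [Module R A] (f : R) (M : Submodule R A) (hM : M.FG) :
    ∃ N : ℕ, ∀ x ∈ M, (∃ n : ℕ, f ^ n • x = 0) → f ^ N • x = 0 := by
  let T : Submodule R A :=
    { carrier := {x | ∃ n : ℕ, f ^ n • x = 0}
      zero_mem' := ⟨0, smul_zero _⟩
      add_mem' := by
        rintro x y ⟨n, hn⟩ ⟨n', hn'⟩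
        refine ⟨n + n', ?_⟩
        rw [smul_add, pow_add, mul_smul, smul_comm, hn, mul_smul, hn', smul_zero, smul_zero,
          add_zero]
      smul_mem' := by
        rintro r x ⟨n, hn⟩
        exact ⟨n, by rw [smul_comm, hn, smul_zero]⟩ }
  have : IsNoetherian R M := isNoetherian_of_fg_of_noetherian M hM
  obtain ⟨s, hs⟩ : (M ⊓ T).FG := isNoetherian_submodule.mp this _ inf_le_left
  have hkill : ∀ᶠ N : ℕ in atTop, ∀ x ∈ s, f ^ N • x = 0 := by
    refine (eventually_all_finset s).mpr fun x hx => ?_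
    have hxT : x ∈ M ⊓ T := hs ▸ Submodule.subset_span hx
    obtain ⟨n, hn⟩ := hxT.2
    filter_upwards [eventually_ge_atTop n] with N hN
    rw [← Nat.sub_add_cancel hN, pow_add, mul_smul, hn, smul_zero]
  obtain ⟨N, hN⟩ := hkill.exists
  have hle : M ⊓ T ≤ LinearMap.ker (LinearMap.lsmul R A (f ^ N)) := by
    rw [← hs, Submodule.span_le]
    exact fun x hx => hN x hx
  exact ⟨N, fun x hx hxT => hle ⟨hx, hxT⟩⟩

/-! ### Patching -/

section Patching

variable {R A B : Type*} [CommRing R] [Ring A] [Algebra R A] [Ring B] [Algebra R B]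

/-- The polynomial `∑ᵢⱼ cᵢⱼ mᵢⱼ tⁱ⁺ʲ`. -/
noncomputable def doubleSum (n : ℕ) (c : ℕ → ℕ → R) (m : ℕ → ℕ → A) : A[X] :=
  ∑ i ∈ range n, ∑ j ∈ range n, monomial (i + j) (c i j • m i j)

theorem coeff_doubleSum_mem {n : ℕ} (c : ℕ → ℕ → R) {m : ℕ → ℕ → A} {V : ℕ → Submodule R A}
    (hm : ∀ i ∈ range n, ∀ j ∈ range n, m i j ∈ V (i + j)) (l : ℕ) :
    (doubleSum n c m).coeff l ∈ V l := by
  simp only [doubleSum, finsetSum_coeff, coeff_monomial]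
  refine sum_mem fun i hi => sum_mem fun j hj => ?_
  split_ifs with h
  · exact h ▸ Submodule.smul_mem _ _ (hm i hi j hj)
  · exact zero_mem _

theorem coeff_zero_doubleSum (n : ℕ) {c : ℕ → ℕ → R} (m : ℕ → ℕ → A) (hc : c 0 0 = 0) :
    (doubleSum n c m).coeff 0 = 0 := by
  simp only [doubleSum, finsetSum_coeff, coeff_monomial]
  refine sum_eq_zero fun i _ => sum_eq_zero fun j _ => ?_
  split_ifs with h
  · obtain ⟨rfl, rfl⟩ : i = 0 ∧ j = 0 := by omega
    rw [hc, zero_smul]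
  · rfl

/-- The substitution `t ↦ a t` as a ring homomorphism. -/
noncomputable def rescale (a : R) : B[X] →+* B[X] :=
  eval₂RingHom' C (C (algebraMap R B a) * X) fun b =>
    Commute.mul_right ((Algebra.commute_algebraMap_right a b).map C) (commute_X _).symm

theorem comp_eq_rescale (a : R) (p : B[X]) :
    p.comp (C (algebraMap R B a) * X) = rescale a p := rfl

theorem rescale_eq_sum {n : ℕ} {p : B[X]} (hn : p.natDegree < n) (a : R) :
    rescale a p = ∑ i ∈ range n, monomial i (a ^ i • p.coeff i) := by
  change eval₂ _ _ p = _
  rw [eval₂_eq_sum_range' _ hn]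
  refine sum_congr rfl fun i _ => ?_
  rw [(commute_X _).symm.mul_pow, ← C_pow, ← mul_assoc, ← C_mul, C_mul_X_pow_eq_monomial,
    ← map_pow, ← Algebra.commutes, ← Algebra.smul_def]

theorem doubleSum_mul_coeff {n : ℕ} {p q : B[X]} (hp : p.natDegree < n) (hq : q.natDegree < n)
    (a b : R) :
    doubleSum n (fun i j => a ^ i * b ^ j) (fun i j => p.coeff i * q.coeff j) =
      rescale a p * rescale b q := by
  simp only [rescale_eq_sum hp, rescale_eq_sum hq, sum_mul_sum, doubleSum, monomial_mul_monomial,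
    smul_mul_smul_comm]

theorem doubleSum_sub (n : ℕ) (c c' : ℕ → ℕ → R) (m : ℕ → ℕ → A) :
    doubleSum n (fun i j => c i j - c' i j) m = doubleSum n c m - doubleSum n c' m := by
  simp only [doubleSum, sub_smul, map_sub, sum_sub_distrib]

/-- If `f ^ K` clears the denominators of `m'`, then multiplying `doubleSum n c m` by `g`
clears those of `c'` as soon as `g f ^ K c = c'`. -/
theorem map_smul_doubleSum (ι : A →ₐ[R] B) {n : ℕ} {c c' : ℕ → ℕ → R} {m : ℕ → ℕ → A}
    {m' : ℕ → ℕ → B} {s g : R} (hm : ∀ i ∈ range n, ∀ j ∈ range n, ι (m i j) = s • m' i j)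
    (hc : ∀ i j, g * s * c i j = c' i j) :
    (g • doubleSum n c m).map (ι : A →+* B) = doubleSum n c' m' := by
  simp only [doubleSum, Polynomial.map_sum, smul_sum, smul_monomial, map_monomial]
  refine sum_congr rfl fun i hi => sum_congr rfl fun j hj => ?_
  congr 1
  change ι _ = _
  rw [map_smul, map_smul, hm i hi j hj, smul_smul, smul_smul, ← hc, mul_right_comm]

theorem one_add_smul_mul_one_add_smul_eq_one (ι : A →ₐ[R] B) {f : R}
    (hι : ∀ x, ι x = 0 → ∃ n : ℕ, f ^ n • x = 0) {M : Submodule R A} {N : ℕ}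
    (hN : ∀ x ∈ M ⊔ M * M, (∃ n : ℕ, f ^ n • x = 0) → f ^ N • x = 0) {Y Z : A[X]}
    (hY : ∀ l, Y.coeff l ∈ M) (hZ : ∀ l, Z.coeff l ∈ M) (r : R)
    (h : ((1 + (f ^ N * r) • Y) * (1 + (f ^ N * r) • Z)).map (ι : A →+* B) = 1) :
    (1 + (f ^ N * r) • Y) * (1 + (f ^ N * r) • Z) = 1 := by
  set W : A[X] := r • (Y + Z + (f ^ N * r) • (Y * Z)) with hW
  have hexp : (1 + (f ^ N * r) • Y) * (1 + (f ^ N * r) • Z) = 1 + f ^ N • W := by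
    simp only [hW, mul_add, add_mul, one_mul, mul_one, smul_add, smul_mul_assoc, mul_smul_comm,
      smul_smul, mul_assoc]
    abel
  have hWmem : ∀ l, W.coeff l ∈ M ⊔ M * M := by
    intro l
    rw [hW, coeff_smul, coeff_add, coeff_add, coeff_smul, coeff_mul]
    refine Submodule.smul_mem _ _ (add_mem (add_mem (le_sup_left (a := M) (hY l))
      (le_sup_left (a := M) (hZ l))) (Submodule.smul_mem _ _ (sum_mem fun ij _ => ?_)))
    exact le_sup_right (a := M) (Submodule.mul_mem_mul (hY _) (hZ _))
  rw [hexp] at h ⊢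
  rw [add_eq_left]
  ext l
  rw [coeff_smul, coeff_zero]
  refine hN _ (hWmem l) ?_
  rw [Polynomial.map_add, Polynomial.map_one, add_eq_left] at h
  have hl : ι (f ^ N • W.coeff l) = 0 := by
    simpa using congrArg (coeff · l) h
  obtain ⟨n, hn⟩ := hι _ hl
  exact ⟨n + N, by rw [pow_add, mul_smul, hn]⟩

/-- Quillen patching for an algebra map `ι : A → B` whose kernel is `f`-power torsion, given
lifts of the products of coefficients of `θ` and of its inverse `η` up to a power of `f`. -/
theorem exists_patching [IsNoetherianRing R] (ι : A →ₐ[R] B) {f : R}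
    (hι : ∀ x, ι x = 0 → ∃ n : ℕ, f ^ n • x = 0) {θ η : B[X]} (hθη : θ * η = 1)
    (hηθ : η * θ = 1) {n : ℕ} (hθn : θ.natDegree < n) (hηn : η.natDegree < n)
    {V : ℕ → Submodule R A} (hV : (1 : A) ∈ V 0) {K : ℕ} {m : ℕ → ℕ → A}
    (hmV : ∀ i ∈ range n, ∀ j ∈ range n, m i j ∈ V (i + j))
    (hm : ∀ i ∈ range n, ∀ j ∈ range n, ι (m i j) = f ^ K • (θ.coeff i * η.coeff j)) :
    ∃ k : ℕ, ∀ a b : R, (∃ r : R, a - b = f ^ k * r) →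
      ∃ ψ : A[X], IsUnit ψ ∧ ψ.coeff 0 = 1 ∧ (∀ l, ψ.coeff l ∈ V l) ∧
        ψ.map (ι : A →+* B) * rescale b θ = rescale a θ := by
  let s : Finset (ℕ × ℕ) := range n ×ˢ range n
  let M : Submodule R A := Submodule.span R ((fun ij => m ij.1 ij.2) '' (s : Set (ℕ × ℕ)))
  have hM : M.FG := Submodule.fg_span ((finite_toSet _).image _)
  have hmM : ∀ i ∈ range n, ∀ j ∈ range n, m i j ∈ M := fun i hi j hj =>
    Submodule.subset_span ⟨(i, j), mem_coe.mpr (mem_product.mpr ⟨hi, hj⟩), rfl⟩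
  obtain ⟨N, hN⟩ := exists_uniform_pow_smul_eq_zero f (M ⊔ M * M) (hM.sup (hM.mul hM))
  refine ⟨N + K, ?_⟩
  rintro a b ⟨r, hr⟩
  let q : ℕ → R := fun i => ∑ s ∈ range i, a ^ s * b ^ (i - 1 - s)
  have hq : ∀ i, f ^ N * r * f ^ K * q i = a ^ i - b ^ i := fun i => by
    rw [← geom_sum₂_mul, hr, pow_add]; ring
  let Y := doubleSum n (fun i j => q i * b ^ j) m
  let Z := doubleSum n (fun i j => b ^ i * q j) m
  have inv : ∀ c : R, rescale c θ * rescale c η = 1 ∧ rescale c η * rescale c θ = 1 := fun c => by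
    rw [← map_mul, ← map_mul, hθη, hηθ, map_one]; exact ⟨rfl, rfl⟩
  have hmapY : (1 + (f ^ N * r) • Y).map (ι : A →+* B) = rescale a θ * rescale b η := by
    rw [Polynomial.map_add, Polynomial.map_one,
      map_smul_doubleSum ι (c' := fun i j => a ^ i * b ^ j - b ^ i * b ^ j) hm
        fun i j => by linear_combination b ^ j * hq i,
      doubleSum_sub, doubleSum_mul_coeff hθn hηn, doubleSum_mul_coeff hθn hηn, (inv b).1]
    abel
  have hmapZ : (1 + (f ^ N * r) • Z).map (ι : A →+* B) = rescale b θ * rescale a η := by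
    rw [Polynomial.map_add, Polynomial.map_one,
      map_smul_doubleSum ι (c' := fun i j => b ^ i * a ^ j - b ^ i * b ^ j) hm
        fun i j => by linear_combination b ^ i * hq j,
      doubleSum_sub, doubleSum_mul_coeff hθn hηn, doubleSum_mul_coeff hθn hηn, (inv b).1]
    abel
  have hYM := coeff_doubleSum_mem (V := fun _ => M) (fun i j => q i * b ^ j) hmM
  have hZM := coeff_doubleSum_mem (V := fun _ => M) (fun i j => b ^ i * q j) hmM
  have hYZ : (1 + (f ^ N * r) • Y) * (1 + (f ^ N * r) • Z) = 1 := by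
    refine one_add_smul_mul_one_add_smul_eq_one ι hι hN hYM hZM r ?_
    rw [Polynomial.map_mul, hmapY, hmapZ, mul_assoc, ← mul_assoc (rescale b η), (inv b).2,
      one_mul, (inv a).1]
  have hZY : (1 + (f ^ N * r) • Z) * (1 + (f ^ N * r) • Y) = 1 := by
    refine one_add_smul_mul_one_add_smul_eq_one ι hι hN hZM hYM r ?_
    rw [Polynomial.map_mul, hmapY, hmapZ, mul_assoc, ← mul_assoc (rescale a η), (inv a).2,
      one_mul, (inv b).1]
  refine ⟨1 + (f ^ N * r) • Y, ⟨⟨_, _, hYZ, hZY⟩, rfl⟩, ?_, fun l => ?_, ?_⟩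
  · rw [coeff_add, coeff_smul, coeff_zero_doubleSum n m (by simp [q]), smul_zero, add_zero,
      coeff_one_zero]
  · rw [coeff_add, coeff_smul, coeff_one]
    refine add_mem ?_ (Submodule.smul_mem _ _ (coeff_doubleSum_mem _ hmV l))
    split_ifs with h
    · exact h ▸ hV
    · exact zero_mem _
  · rw [hmapY, mul_assoc, (inv b).2, mul_one]

end Patching

end EquivariantPatching

/-!
STATEMENT 18 (Lemma `Patching`, equivariant Quillen patching):
Let `R` be a commutative noetherian ring, `P` a finitely generated abelian group, and
`A` a (possibly noncommutative) `P`-graded `R`-algebra.  Let `A[t]` be the polynomial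
ring with `t` central and homogeneous of degree `d ∈ P`.  Let `0 ≠ f ∈ R` and let
`θ = θ(t)` be a unit of `A_f[t]` with `θ(0) = 1` which is homogeneous of degree `0`
(i.e. `G`-invariant).  Then there exists `k ≥ 0` such that for all `a, b ∈ R` with
`a - b ∈ f^k R` there is a degree-zero unit `ψ = ψ(t)` of `A[t]` with `ψ(0) = 1` whose
image in `A_f[t]` equals `θ(at) · θ(bt)⁻¹`.
-/
theorem equivariant_quillen_patching
    (R : Type u) [CommRing R] [IsNoetherianRing R]
    (P : Type u) [AddCommGroup P] [AddGroup.FG P] [DecidableEq P]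
    (A : Type u) [Ring A] [Algebra R A]
    (𝒜 : P → Submodule R A) (h𝒜 : IsGradedRing 𝒜)
    (d : P) (f : R) (hf : f ≠ 0)
    (θ : Polynomial (A ⊗[R] Localization.Away f))
    (hθunit : IsUnit θ) (hθ0 : θ.coeff 0 = 1)
    (hθdeg : θ ∈ polyGrading (tensorLocGrading 𝒜 f) d 0) :
    ∃ k : ℕ, ∀ a b : R, (∃ r : R, a - b = f ^ k * r) →
      ∃ ψ : Polynomial A,
        IsUnit ψ ∧ ψ.coeff 0 = 1 ∧ ψ ∈ polyGrading 𝒜 d 0 ∧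
        Polynomial.map
            (Algebra.TensorProduct.includeLeftRingHom :
              A →+* A ⊗[R] Localization.Away f) ψ *
          θ.comp (Polynomial.C
              (algebraMap R (A ⊗[R] Localization.Away f) b) * Polynomial.X)
        = θ.comp (Polynomial.C
              (algebraMap R (A ⊗[R] Localization.Away f) a) * Polynomial.X) := by
  obtain ⟨⟨θ, η, hθη, hηθ⟩, rfl⟩ := hθunit
  have hηdeg := EquivariantPatching.coeff_mem_of_mul_eq_one
    (EquivariantPatching.one_mem_tensorLocGrading 𝒜 f h𝒜.one_mem)
    (EquivariantPatching.mul_mem_tensorLocGrading h𝒜.mul_mem) hθη hθ0 hθdeg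
  let n := max θ.natDegree η.natDegree + 1
  have hprod : ∀ i j : ℕ, θ.coeff i * η.coeff j ∈ tensorLocGrading 𝒜 f (0 - (i + j) • d) := by
    intro i j
    have hdeg : (0 - i • d) + (0 - j • d) = 0 - (i + j) • d := by rw [add_smul]; abel
    exact hdeg ▸ EquivariantPatching.mul_mem_tensorLocGrading h𝒜.mul_mem (hθdeg i) (hηdeg j)
  obtain ⟨K, hK⟩ := ((Filter.eventually_all_finset (Finset.range n ×ˢ Finset.range n)).mpr
    fun ij _ => EquivariantPatching.eventually_exists_lift f (hprod ij.1 ij.2)).exists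
  choose! m hmV hm using hK
  simp only [EquivariantPatching.comp_eq_rescale]
  exact EquivariantPatching.exists_patching
    (Algebra.TensorProduct.includeLeft : A →ₐ[R] A ⊗[R] Localization.Away f)
    (fun x => EquivariantPatching.exists_pow_smul_eq_zero_of_tmul_one_eq_zero f) hθη hηθ
    (n := n) (by omega) (by omega) (V := fun l => 𝒜 (0 - l • d))
    (by simpa using h𝒜.one_mem) (m := fun i j => m (i, j))
    (fun i hi j hj => hmV (i, j) (Finset.mem_product.mpr ⟨hi, hj⟩))
    (fun i hi j hj => hm (i, j) (Finset.mem_product.mpr ⟨hi, hj⟩))
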